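/- arXiv:2111.05749 — 2 statements merged into one kernel-verified Lean document; each statement's English description precedes it below -/
import Mathlib

section
/- Let p be a prime and A ∈ ℤ^{m×n}. Then the following statements are equivalent: (1) the columns of A form a p-adic generating set for a subspace; (2) the rows of A form a p-adic generating set for a subspace; (3) whenever yᵀA and Ax are both integral vectors (for real vectors y, x), the number yᵀAx is a p-adic rational; (4) there exists a matrix B ∈ ℚ^{n×m} all of whose entries are p-adic rationals such that ABA = A. -/
open Finset

attribute [local instance] Classical.propDecidable

/-- A real number is `p`-adic if it has the form `a / p^k` for integers `a, k`, `k ≥ 0`. -/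
def IsPadic (p : ℕ) (r : ℝ) : Prop := ∃ (a : ℤ) (k : ℕ), r = (a : ℝ) / (p : ℝ) ^ k

/-- A finite family of integral vectors is a `p`-adic generating set for a cone if every
integral vector in its conic hull is a conic combination of the vectors with `p`-adic
coefficients. -/
def IsPGSC (p : ℕ) {ι d : Type} [Fintype ι] [Fintype d] (a : ι → d → ℤ) : Prop :=
  ∀ w : d → ℤ,
    (∃ lam : ι → ℝ, (∀ i, 0 ≤ lam i) ∧ ∀ j, ∑ i, lam i * (a i j : ℝ) = (w j : ℝ)) →
    ∃ lam : ι → ℝ, (∀ i, 0 ≤ lam i) ∧ (∀ i, IsPadic p (lam i)) ∧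
      ∀ j, ∑ i, lam i * (a i j : ℝ) = (w j : ℝ)

/-- A finite family of integral vectors is a `p`-adic generating set for a subspace if every
integral vector in its linear hull is a linear combination of the vectors with `p`-adic
coefficients. -/
def IsPGSS (p : ℕ) {ι d : Type} [Fintype ι] [Fintype d] (a : ι → d → ℤ) : Prop :=
  ∀ w : d → ℤ,
    (∃ lam : ι → ℝ, ∀ j, ∑ i, lam i * (a i j : ℝ) = (w j : ℝ)) →
    ∃ lam : ι → ℝ, (∀ i, IsPadic p (lam i)) ∧
      ∀ j, ∑ i, lam i * (a i j : ℝ) = (w j : ℝ)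

/-- `F` is a face of `P`: the intersection of `P` with a supporting hyperplane (this includes
`P` itself, via `c = 0, δ = 0`). -/
def IsFace {d : Type} [Fintype d] (P F : Set (d → ℝ)) : Prop :=
  ∃ (c : d → ℝ) (δ : ℝ), (∀ x ∈ P, ∑ j, c j * x j ≤ δ) ∧
    F = {x ∈ P | ∑ j, c j * x j = δ}

/-- `y` is feasible for the dual LP `min {bᵀy : Aᵀy = w, y ≥ 0}`. -/
def DualFeasible {m n : ℕ} (A : Matrix (Fin m) (Fin n) ℤ) (w : Fin n → ℤ)
    (y : Fin m → ℝ) : Prop :=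
  (∀ i, 0 ≤ y i) ∧ ∀ j, ∑ i, y i * (A i j : ℝ) = (w j : ℝ)

/-- `y` is an optimal solution of the dual LP `min {bᵀy : Aᵀy = w, y ≥ 0}`. -/
def DualOptimal {m n : ℕ} (A : Matrix (Fin m) (Fin n) ℤ) (b : Fin m → ℤ) (w : Fin n → ℤ)
    (y : Fin m → ℝ) : Prop :=
  DualFeasible A w y ∧
    ∀ y', DualFeasible A w y' → ∑ i, (b i : ℝ) * y i ≤ ∑ i, (b i : ℝ) * y' i

/-- The system `Ax ≤ b` is totally dual `p`-adic. -/
def TotallyDualPadic (p : ℕ) {m n : ℕ} (A : Matrix (Fin m) (Fin n) ℤ) (b : Fin m → ℤ) : Prop :=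
  ∀ w : Fin n → ℤ, (∃ y, DualOptimal A b w y) →
    ∃ y, DualOptimal A b w y ∧ ∀ i, IsPadic p (y i)

/-- A rational number is `p`-adic if it has the form `a / p^k` for integers `a, k`, `k ≥ 0`. -/
def IsPadicRat (p : ℕ) (q : ℚ) : Prop := ∃ (a : ℤ) (k : ℕ), q = (a : ℚ) / (p : ℚ) ^ k


theorem isPadic_intCast (p : ℕ) (a : ℤ) : IsPadic p (a : ℝ) := ⟨a, 0, by simp⟩

theorem IsPadic.add' {p : ℕ} (hp : p.Prime) {r s : ℝ} (hr : IsPadic p r) (hs : IsPadic p s) :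
    IsPadic p (r + s) := by
  obtain ⟨a, k, rfl⟩ := hr
  obtain ⟨b, l, rfl⟩ := hs
  have h : (p : ℝ) ≠ 0 := by exact_mod_cast hp.ne_zero
  refine ⟨a * p ^ l + b * p ^ k, k + l, ?_⟩
  push_cast
  rw [pow_add]
  field_simp

theorem IsPadic.mul' {p : ℕ} {r s : ℝ} (hr : IsPadic p r) (hs : IsPadic p s) :
    IsPadic p (r * s) := by
  obtain ⟨a, k, rfl⟩ := hr
  obtain ⟨b, l, rfl⟩ := hs
  refine ⟨a * b, k + l, ?_⟩
  push_cast
  rw [pow_add, div_mul_div_comm]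

theorem IsPadic.sum' {p : ℕ} (hp : p.Prime) {ι : Type} (s : Finset ι) (f : ι → ℝ)
    (h : ∀ i, IsPadic p (f i)) : IsPadic p (∑ i ∈ s, f i) := by
  classical
  induction s using Finset.induction_on with
  | empty => simpa using isPadic_intCast p 0
  | insert a s ha ih => rw [Finset.sum_insert ha]; exact (h a).add' hp ih

/-- Statement (3). -/
def Cond3 (p : ℕ) {m n : ℕ} (A : Matrix (Fin m) (Fin n) ℤ) : Prop :=
  ∀ (y : Fin m → ℝ) (x : Fin n → ℝ),
        (∀ j, ∃ c : ℤ, ∑ i, y i * (A i j : ℝ) = (c : ℝ)) →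
        (∀ i, ∃ c : ℤ, ∑ j, (A i j : ℝ) * x j = (c : ℝ)) →
        IsPadic p (∑ i, ∑ j, y i * (A i j : ℝ) * x j)

theorem triple_left {m n : ℕ} (A : Matrix (Fin m) (Fin n) ℤ) (y : Fin m → ℝ) (x : Fin n → ℝ) :
    ∑ i, ∑ j, y i * (A i j : ℝ) * x j = ∑ i, y i * ∑ j, (A i j : ℝ) * x j := by
  simp [Finset.mul_sum, mul_assoc]

theorem triple_right {m n : ℕ} (A : Matrix (Fin m) (Fin n) ℤ) (y : Fin m → ℝ) (x : Fin n → ℝ) :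
    ∑ i, ∑ j, y i * (A i j : ℝ) * x j = ∑ j, (∑ i, y i * (A i j : ℝ)) * x j := by
  rw [Finset.sum_comm]; simp [Finset.sum_mul]

theorem cond3_of_one {m n : ℕ} (p : ℕ) (hp : p.Prime) (A : Matrix (Fin m) (Fin n) ℤ)
    (h : IsPGSS p (fun j : Fin n => fun i : Fin m => A i j)) : Cond3 p A := by
  intro y x hy hx
  choose w hw using hx
  choose c hc using hy
  obtain ⟨l, hl, hlw⟩ := h w ⟨x, fun i => by rw [← hw]; simp [mul_comm]⟩
  have : ∑ i, ∑ j, y i * (A i j : ℝ) * x j = ∑ i, ∑ j, y i * (A i j : ℝ) * l j := by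
    rw [triple_left, triple_left]
    refine Finset.sum_congr rfl fun i _ => ?_
    rw [hw, ← hlw]; simp [mul_comm]
  rw [this, triple_right]
  refine IsPadic.sum' hp _ _ fun j => ?_
  rw [hc]
  exact (isPadic_intCast p _).mul' (hl j)

/-- An integer none of whose divisibility relations involve powers of `p` has a nontrivial
divisor coprime to `p`. -/
theorem exists_coprime_dvd (p : ℕ) (hp : p.Prime) (d : ℤ) (hd : ∀ k : ℕ, ¬ d ∣ (p : ℤ) ^ k) :
    ∃ q : ℤ, q ∣ d ∧ ¬ IsUnit q ∧ IsCoprime q (p : ℤ) := by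
  have hpz : Prime (p : ℤ) := Nat.prime_iff_prime_int.mp hp
  by_cases h0 : d = 0
  · refine ⟨p + 1, by simp [h0], ?_, ⟨1, -1, by ring⟩⟩
    have := hp.two_le
    rw [Int.isUnit_iff]; omega
  · have hf : FiniteMultiplicity (p : ℤ) d :=
      FiniteMultiplicity.of_prime_left hpz h0
    obtain ⟨q, hq, hnd⟩ := hf.exists_eq_pow_mul_and_not_dvd
    refine ⟨q, ⟨_, by rw [mul_comm]; exact hq⟩, ?_, ?_⟩
    · intro hu
      refine hd (multiplicity (p : ℤ) d) ?_
      obtain ⟨u, hu⟩ := hu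
      have h1 : d * (↑u⁻¹ : ℤ) = (p : ℤ) ^ multiplicity (p : ℤ) d := by
        conv_lhs => rw [hq, ← hu]
        rw [mul_assoc, Units.mul_inv, mul_one]
      exact ⟨_, h1.symm⟩
    · exact ((Prime.coprime_iff_not_dvd hpz).mpr hnd).symm

theorem one_of_cond3 {m n : ℕ} (p : ℕ) (hp : p.Prime) (A : Matrix (Fin m) (Fin n) ℤ)
    (h : Cond3 p A) : IsPGSS p (fun j : Fin n => fun i : Fin m => A i j) := by
  rintro w ⟨x, hx⟩
  have hp0 : (p : ℝ) ≠ 0 := by exact_mod_cast hp.ne_zero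
  let M : Submodule ℤ (Fin m → ℤ) := LinearMap.range A.mulVecLin
  by_cases hk : ∃ k : ℕ, ((p : ℤ) ^ k) • w ∈ M
  · obtain ⟨k, z, hz⟩ := hk
    refine ⟨fun j => (z j : ℝ) / (p : ℝ) ^ k, fun j => ⟨z j, k, rfl⟩, fun i => ?_⟩
    have h1 := congrFun hz i
    simp only [Matrix.mulVecLin_apply, Matrix.mulVec, dotProduct, Pi.smul_apply,
      smul_eq_mul] at h1
    have h2 : (∑ j, (A i j : ℝ) * (z j : ℝ)) = (p : ℝ) ^ k * w i := by exact_mod_cast h1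
    have h3 : ∑ j, (z j : ℝ) / (p : ℝ) ^ k * (A i j : ℝ)
        = (∑ j, (A i j : ℝ) * (z j : ℝ)) / (p : ℝ) ^ k := by
      rw [Finset.sum_div]
      refine Finset.sum_congr rfl fun j _ => by ring
    rw [h3, h2]
    field_simp
  exfalso
  push Not at hk
  let I : Ideal ℤ := M.comap (LinearMap.toSpanSingleton ℤ (Fin m → ℤ) w)
  have hI : ∀ t : ℤ, t ∈ I ↔ t • w ∈ M := fun t => Iff.rfl
  obtain ⟨d, hd⟩ := (IsPrincipalIdealRing.principal I).principal
  have hId : ∀ t : ℤ, t ∈ I ↔ d ∣ t := fun t => by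
    rw [hd]; exact Ideal.mem_span_singleton
  obtain ⟨q, hqd, hqu, hqp⟩ := exists_coprime_dvd p hp d fun k hdk =>
    hk k ((hI _).1 ((hId _).2 hdk))
  let N : Submodule ℤ (Fin m → ℤ) := M ⊔ Submodule.span ℤ {q • w}
  have hwN : w ∉ N := by
    intro hw
    obtain ⟨u, hu, v, hv, huv⟩ := Submodule.mem_sup.1 hw
    obtain ⟨t, rfl⟩ := Submodule.mem_span_singleton.1 hv
    have : (1 - t * q) • w ∈ M := by
      have : (1 - t * q) • w = u := by
        rw [sub_smul, one_smul, mul_smul]; exact sub_eq_of_eq_add huv.symm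
      rwa [this]
    have h1 : q ∣ 1 - t * q := hqd.trans ((hId _).1 ((hI _).2 this))
    apply hqu
    rw [isUnit_iff_dvd_one]
    have := dvd_add h1 (Dvd.intro_left t rfl)
    simpa using this
  obtain ⟨c, hc⟩ := CharacterModule.exists_character_apply_ne_zero_of_ne_zero
    (A := (Fin m → ℤ) ⧸ N) (a := N.mkQ w) (by simpa using hwN)
  let φ : (Fin m → ℤ) →+ AddCircle (1 : ℚ) := AddMonoidHom.comp c N.mkQ.toAddMonoidHom
  have hφN : ∀ v ∈ N, φ v = 0 := fun v hv => by
    have : N.mkQ v = 0 := by simpa using hv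
    show c (N.mkQ v) = 0
    rw [this, map_zero]
  have hφw : φ w ≠ 0 := hc
  have hl : ∀ i : Fin m, ∃ y : ℚ, (y : AddCircle (1 : ℚ)) = φ (Pi.single i 1) := fun i =>
    QuotientAddGroup.mk_surjective _
  choose y hy using hl
  have hφ : ∀ v : Fin m → ℤ, φ v = ((∑ i, y i * (v i : ℚ) : ℚ) : AddCircle (1 : ℚ)) := by
    intro v
    have hv : v = ∑ i, v i • (Pi.single i 1 : Fin m → ℤ) := by
      ext j; simp [Finset.sum_apply, Pi.single_apply]
    conv_lhs => rw [hv]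
    rw [map_sum]
    have : ((∑ i, y i * (v i : ℚ) : ℚ) : AddCircle (1 : ℚ)) =
        ∑ i, ((y i * (v i : ℚ) : ℚ) : AddCircle (1 : ℚ)) :=
      map_sum (QuotientAddGroup.mk' (AddSubgroup.zmultiples (1 : ℚ))) _ _
    rw [this]
    refine Finset.sum_congr rfl fun i _ => ?_
    rw [map_zsmul, ← hy, ← AddCircle.coe_zsmul, zsmul_eq_mul, mul_comm]
  have hz : ∀ r : ℚ, (r : AddCircle (1 : ℚ)) = 0 ↔ ∃ a : ℤ, r = a := by
    intro r
    rw [AddCircle.coe_eq_zero_iff]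
    constructor
    · rintro ⟨a, ha⟩; exact ⟨a, by simpa using ha.symm⟩
    · rintro ⟨a, ha⟩; exact ⟨a, by simpa using ha.symm⟩
  have hpad := h (fun i => (y i : ℝ)) x (fun j => by
    have : (fun i => A i j) ∈ N := Submodule.mem_sup_left
      ⟨Pi.single j 1, by ext i; simp⟩
    have h1 := hφN _ this
    rw [hφ, hz] at h1
    obtain ⟨a, ha⟩ := h1
    exact ⟨a, by exact_mod_cast congrArg (Rat.cast : ℚ → ℝ) ha⟩)
    (fun i => ⟨w i, by rw [← hx]; simp [mul_comm]⟩)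
  have hxw : ∀ i, ∑ j, (A i j : ℝ) * x j = w i := fun i => by rw [← hx]; simp [mul_comm]
  rw [triple_left] at hpad
  simp only [hxw] at hpad
  obtain ⟨a, k, hak⟩ := hpad
  have hqw : q • w ∈ N := Submodule.mem_sup_right (Submodule.mem_span_singleton_self _)
  have h2 := hφN _ hqw
  rw [hφ, hz] at h2
  obtain ⟨b, hb⟩ := h2
  have h3 : (q : ℝ) * (∑ i, (y i : ℝ) * (w i : ℝ)) = b := by
    have := congrArg (Rat.cast : ℚ → ℝ) hb
    push_cast [Pi.smul_apply, smul_eq_mul] at this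
    rw [← this, Finset.mul_sum]
    refine Finset.sum_congr rfl fun i _ => by ring
  have h4 : q * a = b * (p : ℤ) ^ k := by
    rw [hak] at h3
    field_simp at h3
    rw [mul_comm b]
    exact_mod_cast h3
  have h5 : (p : ℤ) ^ k ∣ a := by
    have hcop : IsCoprime ((p : ℤ) ^ k) q := hqp.symm.pow_left
    exact hcop.dvd_of_dvd_mul_left ⟨b, by rw [h4, mul_comm]⟩
  obtain ⟨e, rfl⟩ := h5
  apply hφw
  rw [hφ, hz]
  refine ⟨e, ?_⟩
  have : (∑ i, (y i : ℝ) * (w i : ℝ)) = e := by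
    rw [hak]; push_cast; field_simp
  exact_mod_cast this

theorem four_of_one {m n : ℕ} (p : ℕ) (A : Matrix (Fin m) (Fin n) ℤ)
    (h : IsPGSS p (fun j : Fin n => fun i : Fin m => A i j)) :
    ∃ B : Matrix (Fin n) (Fin m) ℚ, (∀ j i, IsPadicRat p (B j i)) ∧
        A.map (Int.cast : ℤ → ℚ) * B * A.map (Int.cast : ℤ → ℚ) =
          A.map (Int.cast : ℤ → ℚ) := by
  let S : Submodule ℝ (Fin m → ℝ) := LinearMap.range (A.map (Int.cast : ℤ → ℝ)).mulVecLin
  let L : Submodule ℤ (Fin m → ℤ) :=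
    { carrier := {w | (fun i => (w i : ℝ)) ∈ S}
      zero_mem' := by
        have : (fun i => (((0 : Fin m → ℤ) i : ℤ) : ℝ)) = 0 := by ext; simp
        show _ ∈ S
        rw [this]; exact S.zero_mem
      add_mem' := by
        intro a b ha hb
        have : (fun i => (((a + b : Fin m → ℤ) i : ℤ) : ℝ)) =
          (fun i => (a i : ℝ)) + (fun i => (b i : ℝ)) := by ext; simp
        show _ ∈ S
        rw [this]; exact S.add_mem ha hb
      smul_mem' := by
        intro c a ha
        have : (fun i => (((c • a : Fin m → ℤ) i : ℤ) : ℝ)) =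
          (c : ℝ) • (fun i => (a i : ℝ)) := by ext; simp
        show _ ∈ S
        rw [this]; exact S.smul_mem _ ha }
  have hL : ∀ w, w ∈ L ↔ (fun i => (w i : ℝ)) ∈ S := fun w => Iff.rfl
  have hsat : ∀ (c : ℤ) (w : Fin m → ℤ), c ≠ 0 → c • w ∈ L → w ∈ L := by
    intro c w hc hw
    rw [hL] at hw ⊢
    have : (fun i => (((c • w : Fin m → ℤ) i : ℤ) : ℝ)) =
          (c : ℝ) • (fun i => (w i : ℝ)) := by ext; simp
    rw [this] at hw
    exact (S.smul_mem_iff (by exact_mod_cast hc)).1 hw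
  have : Module.IsTorsionFree ℤ ((Fin m → ℤ) ⧸ L) := by
    rw [Module.isTorsionFree_iff_smul_eq_zero]
    intro c v hv
    obtain ⟨v, rfl⟩ := L.mkQ_surjective v
    rw [← map_smul] at hv
    by_cases hc : c = 0
    · exact Or.inl hc
    · right
      simp only [Submodule.mkQ_apply, Submodule.Quotient.mk_eq_zero] at hv ⊢
      exact hsat c v hc hv
  have : Module.Free ℤ ((Fin m → ℤ) ⧸ L) := Module.free_of_finite_type_torsion_free'
  obtain ⟨s, hs⟩ := Module.projective_lifting_property L.mkQ LinearMap.id L.mkQ_surjective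
  let P : (Fin m → ℤ) →ₗ[ℤ] (Fin m → ℤ) := LinearMap.id - s.comp L.mkQ
  have hPL : ∀ v, P v ∈ L := by
    intro v
    have : L.mkQ (P v) = 0 := by
      have := LinearMap.congr_fun hs (L.mkQ v)
      simp only [LinearMap.comp_apply, LinearMap.id_apply] at this
      simp only [P, LinearMap.sub_apply, LinearMap.comp_apply, LinearMap.id_apply, map_sub, this,
        sub_self]
    simpa using this
  have hPid : ∀ v ∈ L, P v = v := by
    intro v hv
    have : L.mkQ v = 0 := by simpa using hv
    simp only [P, LinearMap.sub_apply, LinearMap.comp_apply, LinearMap.id_apply, this, map_zero,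
      sub_zero]
  have hx : ∀ i : Fin m, ∃ l : Fin n → ℝ, (∀ j, IsPadic p (l j)) ∧
      ∀ r, ∑ j, l j * (A r j : ℝ) = (P (Pi.single i 1) r : ℝ) := by
    intro i
    apply h
    obtain ⟨x, hx⟩ := hPL (Pi.single i 1)
    refine ⟨x, fun r => ?_⟩
    have := congrFun hx r
    simp only [Matrix.mulVecLin_apply, Matrix.mulVec, dotProduct, Matrix.map_apply] at this
    rw [← this]
    simp [mul_comm]
  choose l hl hlP using hx
  choose a k hak using hl
  let B : Matrix (Fin n) (Fin m) ℚ := fun j i => (a i j : ℚ) / (p : ℚ) ^ (k i j)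
  have hAB : A.map (Int.cast : ℤ → ℚ) * B = (LinearMap.toMatrix' P).map (Int.cast : ℤ → ℚ) := by
    ext r i
    have := hlP i r
    simp only [hak] at this
    rw [Matrix.mul_apply, Matrix.map_apply, LinearMap.toMatrix'_apply]
    have h2 : ∑ j, (a i j : ℚ) / (p : ℚ) ^ (k i j) * (A r j : ℚ) = (P (Pi.single i 1) r : ℚ) := by
      exact_mod_cast this
    rw [← h2]
    exact Finset.sum_congr rfl fun j _ => mul_comm _ _
  refine ⟨B, fun j i => ⟨a i j, k i j, rfl⟩, ?_⟩
  rw [hAB]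
  have hPA : LinearMap.toMatrix' P * A = A := by
    ext r j
    have hm : (fun i => A i j) ∈ L := by
      refine ⟨Pi.single j 1, ?_⟩
      ext i; simp
    have h1 := congrFun (hPid _ hm) r
    have h2 := congrFun (LinearMap.toMatrix'_mulVec P (fun i => A i j)) r
    rw [h1] at h2
    exact h2
  have := congrArg (fun M : Matrix (Fin m) (Fin n) ℤ => M.map (Int.castRingHom ℚ)) hPA
  simp only [Matrix.map_mul] at this
  exact this

theorem one_of_four {m n : ℕ} (p : ℕ) (hp : p.Prime) (A : Matrix (Fin m) (Fin n) ℤ)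
    (h : ∃ B : Matrix (Fin n) (Fin m) ℚ, (∀ j i, IsPadicRat p (B j i)) ∧
        A.map (Int.cast : ℤ → ℚ) * B * A.map (Int.cast : ℤ → ℚ) =
          A.map (Int.cast : ℤ → ℚ)) :
    IsPGSS p (fun j : Fin n => fun i : Fin m => A i j) := by
  obtain ⟨B, hB, hABA⟩ := h
  rintro w ⟨x, hx⟩
  let A' : Matrix (Fin m) (Fin n) ℝ := A.map (Int.cast : ℤ → ℝ)
  let B' : Matrix (Fin n) (Fin m) ℝ := B.map (Rat.castHom ℝ)
  have hA' : (A.map (Int.cast : ℤ → ℚ)).map (Rat.castHom ℝ) = A' := by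
    ext i j; simp [A']
  have h1 : A' * B' * A' = A' := by
    have := congrArg (fun M : Matrix (Fin m) (Fin n) ℚ => M.map (Rat.castHom ℝ)) hABA
    simp only [Matrix.map_mul, hA'] at this
    exact this
  let w' : Fin m → ℝ := fun i => (w i : ℝ)
  have hw : A'.mulVec x = w' := by
    ext i
    show _ = (w i : ℝ)
    rw [← hx i]
    simp [A', Matrix.mulVec, dotProduct, mul_comm]
  have h2 : A'.mulVec (B'.mulVec w') = w' := by
    rw [← hw, Matrix.mulVec_mulVec, Matrix.mulVec_mulVec, h1]
  refine ⟨B'.mulVec w', fun j => ?_, fun i => ?_⟩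
  · show IsPadic p (∑ i, B' j i * (w i : ℝ))
    refine IsPadic.sum' hp _ _ fun i => IsPadic.mul' ?_ (isPadic_intCast p (w i))
    obtain ⟨a, k, hak⟩ := hB j i
    exact ⟨a, k, by simp [B', hak]⟩
  · have := congrFun h2 i
    show _ = w' i
    rw [← this]
    conv_rhs => rw [Matrix.mulVec, dotProduct]
    exact Finset.sum_congr rfl fun j _ => mul_comm _ _

theorem cond3_transpose {m n : ℕ} (p : ℕ) (A : Matrix (Fin m) (Fin n) ℤ) (h : Cond3 p A) :
    Cond3 p A.transpose := by
  intro y x hy hx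
  have := h x y (fun j => by
      obtain ⟨c, hc⟩ := hx j
      exact ⟨c, by rw [← hc]; simp [mul_comm]⟩) (fun i => by
      obtain ⟨c, hc⟩ := hy i
      exact ⟨c, by rw [← hc]; simp [mul_comm]⟩)
  rw [Finset.sum_comm] at this
  have e : ∑ i, ∑ j, y i * (A.transpose i j : ℝ) * x j =
      ∑ i, ∑ j, x j * (A j i : ℝ) * y i :=
    Finset.sum_congr rfl fun i _ => Finset.sum_congr rfl fun j _ => by
      rw [Matrix.transpose_apply]; ring
  rw [e]
  exact this

/-- For a prime `p` and an integral matrix `A`, the following are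
equivalent: the columns of `A` form a `p`-GSS; the rows of `A` form a `p`-GSS; whenever
`yᵀA` and `Ax` are integral, `yᵀAx` is a `p`-adic rational; there is a matrix `B` with
`p`-adic rational entries such that `ABA = A`. -/
theorem pGSS_characterization {m n : ℕ} (p : ℕ) (hp : p.Prime)
    (A : Matrix (Fin m) (Fin n) ℤ) :
    (IsPGSS p (fun j : Fin n => fun i : Fin m => A i j) ↔
      IsPGSS p (fun i : Fin m => fun j : Fin n => A i j)) ∧
    (IsPGSS p (fun j : Fin n => fun i : Fin m => A i j) ↔
      ∀ (y : Fin m → ℝ) (x : Fin n → ℝ),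
        (∀ j, ∃ c : ℤ, ∑ i, y i * (A i j : ℝ) = (c : ℝ)) →
        (∀ i, ∃ c : ℤ, ∑ j, (A i j : ℝ) * x j = (c : ℝ)) →
        IsPadic p (∑ i, ∑ j, y i * (A i j : ℝ) * x j)) ∧
    (IsPGSS p (fun j : Fin n => fun i : Fin m => A i j) ↔
      ∃ B : Matrix (Fin n) (Fin m) ℚ, (∀ j i, IsPadicRat p (B j i)) ∧
        A.map (Int.cast : ℤ → ℚ) * B * A.map (Int.cast : ℤ → ℚ) =
          A.map (Int.cast : ℤ → ℚ)) := by
  refine ⟨⟨fun h => ?_, fun h => ?_⟩, ⟨fun h => cond3_of_one p hp A h, fun h => one_of_cond3 p hp A h⟩,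
    ⟨fun h => four_of_one p A h, fun h => one_of_four p hp A h⟩⟩
  · exact one_of_cond3 p hp A.transpose (cond3_transpose p A (cond3_of_one p hp A h))
  · exact one_of_cond3 p hp A (cond3_transpose p A.transpose (cond3_of_one p hp A.transpose h))
end

section
/- Let A ∈ ℤ^{m×n}, b ∈ ℤ^m, and P := {x : Ax ≤ b}. Then the following are equivalent: (1) Ax ≤ b is totally dual p-adic for every prime p; (2) Ax ≤ b is totally dual p-adic and totally dual q-adic for two distinct primes p, q; (3) for every nonempty face F of P, the greatest common divisor of the subdeterminants of A_F of order rank(A_F) equals 1. -/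
open Finset

attribute [local instance] Classical.propDecidable

theorem farkas_aux {W : Type} [AddCommGroup W] [Module ℝ W] : ∀ (k : ℕ) (g : Fin k → W →ₗ[ℝ] ℝ)
    (v : W →ₗ[ℝ] ℝ), (∀ x, (∀ i, 0 ≤ g i x) → 0 ≤ v x) →
    ∃ c : Fin k → ℝ, (∀ i, 0 ≤ c i) ∧ ∀ x, v x = ∑ i, c i * g i x := by
  intro k
  induction k with
  | zero =>
    intro g v h
    refine ⟨fun _ => 0, fun _ => le_rfl, fun x => ?_⟩
    have h1 := h x (fun i => i.elim0)
    have h2 := h (-x) (fun i => i.elim0)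
    rw [map_neg] at h2
    simp
    linarith
  | succ k ih =>
    intro g v h
    by_cases hc : ∀ x, (∀ i : Fin k, 0 ≤ g i.succ x) → 0 ≤ v x
    · obtain ⟨c, hc0, hc1⟩ := ih (fun i => g i.succ) v hc
      refine ⟨Fin.cons 0 c, ?_, ?_⟩
      · intro i
        refine Fin.cases ?_ (fun i => ?_) i
        · simp
        · simpa using hc0 i
      · intro x
        rw [Fin.sum_univ_succ]
        simp [hc1 x]
    · push Not at hc
      obtain ⟨x0, hx0, hv0⟩ := hc
      have hh : g 0 x0 < 0 := by
        by_contra hcon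
        push Not at hcon
        have := h x0 (fun i => Fin.cases hcon hx0 i)
        linarith
      set t := (g 0 x0)⁻¹ with ht
      have ht0 : t < 0 := inv_lt_zero.mpr hh
      have htt : t * g 0 x0 = 1 := inv_mul_cancel₀ hh.ne
      obtain ⟨c, hc0, hc1⟩ := ih (fun i => g i.succ - (t * g i.succ x0) • g 0)
        (v - (t * v x0) • g 0) (by
          intro x hx
          have := h (x - (t * g 0 x) • x0) (by
            intro i
            refine Fin.cases ?_ (fun i => ?_) i
            · simp only [map_sub, map_smul, smul_eq_mul]
              have : t * g 0 x * g 0 x0 = g 0 x * (t * g 0 x0) := by ring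
              rw [this, htt]; simp
            · have := hx i
              simp only [map_sub, map_smul, smul_eq_mul, LinearMap.sub_apply, LinearMap.smul_apply] at this ⊢
              linarith)
          simp only [map_sub, map_smul, smul_eq_mul, LinearMap.sub_apply, LinearMap.smul_apply] at this ⊢
          linarith)
      refine ⟨Fin.cons (t * v x0 - ∑ i, c i * (t * g i.succ x0)) c, ?_, ?_⟩
      · intro i
        refine Fin.cases ?_ (fun i => ?_) i
        · simp only [Fin.cons_zero]
          have h1 : 0 ≤ t * v x0 := mul_nonneg_of_nonpos_of_nonpos ht0.le hv0.le
          have h2 : ∑ i, c i * (t * g i.succ x0) ≤ 0 := Finset.sum_nonpos (fun i _ =>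
            mul_nonpos_of_nonneg_of_nonpos (hc0 i) (mul_nonpos_of_nonpos_of_nonneg ht0.le (hx0 i)))
          linarith
        · simpa using hc0 i
      · intro x
        have := hc1 x
        rw [Fin.sum_univ_succ]
        simp only [LinearMap.sub_apply, LinearMap.smul_apply, smul_eq_mul, mul_sub,
          Finset.sum_sub_distrib] at this
        simp only [Fin.cons_zero, Fin.cons_succ, sub_mul, Finset.sum_mul]
        have e : ∑ i, c i * (t * g i.succ x0 * g 0 x) = ∑ i, c i * (t * g i.succ x0) * g 0 x :=
          Finset.sum_congr rfl (fun i _ => by ring)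
        rw [e] at this
        linarith

/-- the functional `(x, t) ↦ β t + α·x`. -/
noncomputable def affFun {n : ℕ} (α : Fin n → ℝ) (β : ℝ) : ((Fin n → ℝ) × ℝ) →ₗ[ℝ] ℝ where
  toFun z := β * z.2 + ∑ j, α j * z.1 j
  map_add' x y := by
    simp only [Prod.fst_add, Prod.snd_add, Pi.add_apply, mul_add, Finset.sum_add_distrib]; ring
  map_smul' c x := by
    simp only [Prod.smul_fst, Prod.smul_snd, Pi.smul_apply, smul_eq_mul, RingHom.id_apply, mul_add,
      Finset.mul_sum]
    congr 1
    · ring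
    · exact Finset.sum_congr rfl (fun i _ => by ring)

theorem affFun_apply {n : ℕ} (α : Fin n → ℝ) (β : ℝ) (z : (Fin n → ℝ) × ℝ) :
    affFun α β z = β * z.2 + ∑ j, α j * z.1 j := rfl

theorem core_alt {m n : ℕ} (A : Fin m → Fin n → ℝ) (b : Fin m → ℝ) (w : Fin n → ℝ) (δ : ℝ)
    (α : Fin n → ℝ) (β : ℝ) :
    (∃ (x : Fin n → ℝ) (t : ℝ), 0 ≤ t ∧ (∀ k, ∑ j, A k j * x j ≤ b k * t) ∧
      δ * t ≤ ∑ j, w j * x j ∧ ∑ j, α j * x j < β * t) ∨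
    (∃ (y : Fin m → ℝ) (s : ℝ), (∀ k, 0 ≤ y k) ∧ 0 ≤ s ∧
      (∀ j, ∑ k, y k * A k j + α j = s * w j) ∧ ∑ k, b k * y k + β ≤ s * δ) := by
  by_cases H : ∀ z : (Fin n → ℝ) × ℝ,
      (∀ i, 0 ≤ (Fin.cons (affFun w (-δ)) (Fin.cons (affFun 0 1)
        (fun k => affFun (fun j => - A k j) (b k))) : Fin (m+1+1) → _ →ₗ[ℝ] ℝ) i z) →
      0 ≤ affFun α (-β) z
  · right
    obtain ⟨c, hc0, hc⟩ := farkas_aux _ _ _ H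
    refine ⟨fun k => c k.succ.succ, c 0, fun k => hc0 _, hc0 _, ?_, ?_⟩
    · intro j
      have := hc (Pi.single j 1, 0)
      simp [Fin.sum_univ_succ, affFun_apply, Pi.single_apply] at this
      linarith
    · have := hc (0, 1)
      have h1 := hc0 1
      simp [Fin.sum_univ_succ, affFun_apply] at this
      simp only [mul_comm (b _)]
      linarith
  · left
    push Not at H
    obtain ⟨⟨x, t⟩, h1, h2⟩ := H
    simp only [Fin.forall_fin_succ, Fin.cons_zero, Fin.cons_succ, affFun_apply] at h1 h2
    obtain ⟨h3, h4, h5⟩ := h1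
    refine ⟨x, t, by simpa using h4, fun k => ?_, by linarith, by linarith⟩
    have := h5 k
    simp at this
    linarith

theorem weak_duality {m n : ℕ} {A : Matrix (Fin m) (Fin n) ℤ} {b : Fin m → ℤ} {w : Fin n → ℤ}
    {y : Fin m → ℝ} (hy : ∀ j, ∑ i, y i * (A i j : ℝ) = (w j : ℝ)) (x : Fin n → ℝ) :
    ∑ i, y i * ((b i : ℝ) - ∑ j, (A i j : ℝ) * x j) =
      ∑ i, (b i : ℝ) * y i - ∑ j, (w j : ℝ) * x j := by
  simp only [mul_sub, Finset.sum_sub_distrib, ← hy, Finset.sum_mul, Finset.mul_sum]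
  congr 1
  · exact Finset.sum_congr rfl (fun i _ => by ring)
  · rw [Finset.sum_comm]
    exact Finset.sum_congr rfl (fun i _ => Finset.sum_congr rfl (fun i _ => by ring))

/-- from a pair `(y, s)`, produce a dual feasible solution. -/
theorem dual_combine {m n : ℕ} {A : Matrix (Fin m) (Fin n) ℤ} {b : Fin m → ℤ} {w : Fin n → ℤ}
    {y : Fin m → ℝ} (hy : DualOptimal A b w y) {z : Fin m → ℝ} {s : ℝ} (hz : ∀ k, 0 ≤ z k)
    (hs : 0 ≤ s) (h : ∀ j, ∑ k, z k * (A k j : ℝ) = s * w j)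
    (hb : ∑ k, (b k : ℝ) * z k ≤ s * ∑ k, (b k : ℝ) * y k) :
    s * ∑ k, (b k : ℝ) * y k ≤ ∑ k, (b k : ℝ) * z k ∧
    ∀ k, 0 < z k → ∃ y', DualOptimal A b w y' ∧ 0 < y' k := by
  have hs1 : 0 < 1 + s := by linarith
  have hf : DualFeasible A w (fun k => (1 + s)⁻¹ * (y k + z k)) := by
    refine ⟨fun k => mul_nonneg (inv_nonneg.mpr hs1.le) (add_nonneg (hy.1.1 k) (hz k)), fun j => ?_⟩
    simp only [mul_assoc, ← Finset.mul_sum, add_mul, Finset.sum_add_distrib, h, hy.1.2]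
    field_simp
  have hv : ∑ k, (b k : ℝ) * ((1 + s)⁻¹ * (y k + z k)) =
      (1 + s)⁻¹ * (∑ k, (b k : ℝ) * y k + ∑ k, (b k : ℝ) * z k) := by
    rw [← Finset.sum_add_distrib, Finset.mul_sum]
    exact Finset.sum_congr rfl (fun i _ => by ring)
  have h1 := hy.2 _ hf
  rw [hv] at h1
  have h2 : (1 + s) * ∑ k, (b k : ℝ) * y k ≤ ∑ k, (b k : ℝ) * y k + ∑ k, (b k : ℝ) * z k := by
    rw [inv_mul_eq_div, le_div_iff₀ hs1] at h1
    linarith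
  refine ⟨by linarith, fun k hk => ⟨_, ⟨hf, fun y' hy' => ?_⟩,
    mul_pos (inv_pos.mpr hs1) (add_pos_of_nonneg_of_pos (hy.1.1 k) hk)⟩⟩
  refine le_trans ?_ (hy.2 y' hy')
  rw [hv, inv_mul_eq_div, div_le_iff₀ hs1]
  linarith

theorem primal_nonempty {m n : ℕ} {A : Matrix (Fin m) (Fin n) ℤ} {b : Fin m → ℤ} {w : Fin n → ℤ}
    {y : Fin m → ℝ} (hy : DualOptimal A b w y) :
    ∃ x : Fin n → ℝ, (∀ i, ∑ j, (A i j : ℝ) * x j ≤ (b i : ℝ)) ∧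
      ∑ k, (b k : ℝ) * y k ≤ ∑ j, (w j : ℝ) * x j := by
  rcases core_alt (fun i j => (A i j : ℝ)) (fun i => (b i : ℝ)) (fun j => (w j : ℝ))
    (∑ k, (b k : ℝ) * y k) 0 1 with ⟨x, t, ht, h1, h2, h3⟩ | ⟨z, s, hz, hs, h1, h2⟩
  · simp at h3
    refine ⟨fun j => t⁻¹ * x j, fun i => ?_, ?_⟩
    · have := h1 i
      simp only [mul_left_comm _ t⁻¹, ← Finset.mul_sum]
      rw [inv_mul_eq_div, div_le_iff₀ h3]; exact this
    · simp only [mul_left_comm _ t⁻¹, ← Finset.mul_sum]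
      rw [inv_mul_eq_div, le_div_iff₀ h3]; exact h2
  · exfalso
    have := (dual_combine hy hz hs (fun j => by simpa using h1 j) (by linarith)).1
    linarith

theorem primal_strict {m n : ℕ} {A : Matrix (Fin m) (Fin n) ℤ} {b : Fin m → ℤ} {w : Fin n → ℤ}
    {y : Fin m → ℝ} (hy : DualOptimal A b w y) (i : Fin m)
    (hi : ∀ x : Fin n → ℝ, (∀ i, ∑ j, (A i j : ℝ) * x j ≤ (b i : ℝ)) →
      ∑ k, (b k : ℝ) * y k ≤ ∑ j, (w j : ℝ) * x j → (b i : ℝ) ≤ ∑ j, (A i j : ℝ) * x j) :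
    ∃ y', DualOptimal A b w y' ∧ 0 < y' i := by
  rcases core_alt (fun i j => (A i j : ℝ)) (fun i => (b i : ℝ)) (fun j => (w j : ℝ))
    (∑ k, (b k : ℝ) * y k) (fun j => (A i j : ℝ)) (b i) with
    ⟨x, t, ht, h1, h2, h3⟩ | ⟨z, s, hz, hs, h1, h2⟩
  · exfalso
    obtain ⟨x0, hx0, hx1⟩ := primal_nonempty hy
    have ht1 : 0 < 1 + t := by linarith
    have e : ∀ c : Fin n → ℝ, ∑ j, c j * ((1 + t)⁻¹ * (x0 j + x j)) =
        (1 + t)⁻¹ * (∑ j, c j * x0 j + ∑ j, c j * x j) := by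
      intro c
      rw [← Finset.sum_add_distrib, Finset.mul_sum]
      exact Finset.sum_congr rfl (fun i _ => by ring)
    have := hi (fun j => (1 + t)⁻¹ * (x0 j + x j)) (fun k => by
      rw [e, inv_mul_eq_div, div_le_iff₀ ht1]
      linarith [hx0 k, h1 k]) (by
      rw [e, inv_mul_eq_div, le_div_iff₀ ht1]
      linarith)
    rw [e, inv_mul_eq_div, le_div_iff₀ ht1] at this
    linarith [hx0 i]
  · refine (dual_combine hy (z := fun k => z k + if k = i then 1 else 0) (s := s) ?_ hs ?_ ?_).2 i ?_
    · intro k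
      have := hz k
      positivity
    · intro j
      simp only [add_mul, Finset.sum_add_distrib, ite_mul, one_mul, zero_mul]
      simpa using h1 j
    · simp only [mul_add, Finset.sum_add_distrib, mul_ite, mul_one, mul_zero]
      simpa using h2
    · have := hz i
      simp; linarith

theorem exists_indep_rows {K I J : Type} [Field K] [Finite I] [Fintype J] {r : ℕ}
    (M : Matrix I J K) (h : r ≤ M.rank) :
    ∃ f : Fin r → I, LinearIndependent K (fun k => M (f k)) := by
  have hfin : (Set.range M.row).Finite := Set.finite_range _
  rw [Matrix.rank_eq_finrank_span_row] at h
  obtain ⟨g, hg1, hg2, hg3⟩ := Submodule.exists_fun_fin_finrank_span_eq K (Set.range M.row)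
  choose f hf using hg1
  refine ⟨fun k => f (Fin.castLE h k), ?_⟩
  have : (fun k : Fin r => M (f (Fin.castLE h k))) = g ∘ Fin.castLE h := by
    funext k
    exact hf _
  rw [this]
  exact hg3.comp _ (Fin.castLE_injective h)

theorem exists_minor {K I : Type} [Field K] [Finite I] {n r : ℕ}
    (M : Matrix I (Fin n) K) (h : r ≤ M.rank) :
    ∃ (f : Fin r → I) (g : Fin r → Fin n), Function.Injective f ∧ Function.Injective g ∧
      (Matrix.of (fun i j => M (f i) (g j))).det ≠ 0 := by
  obtain ⟨f, hf⟩ := exists_indep_rows M h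
  have hr : (Matrix.of (fun (k : Fin r) => M (f k))).rank = r := by
    have := LinearIndependent.rank_matrix (M := Matrix.of (fun (k : Fin r) => M (f k))) hf
    simpa using this
  rw [← Matrix.rank_transpose] at hr
  obtain ⟨g, hg⟩ := exists_indep_rows _ hr.ge
  refine ⟨f, g, ?_, ?_, ?_⟩
  · intro i j hij
    exact hf.injective (by simp [hij])
  · intro i j hij
    exact hg.injective (by simp [hij])
  · have h2 : IsUnit (Matrix.of (fun (i j : Fin r) => M (f i) (g j))).transpose := by
      rw [← Matrix.linearIndependent_rows_iff_isUnit]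
      exact hg
    rw [Matrix.isUnit_iff_isUnit_det, Matrix.det_transpose] at h2
    exact h2.ne_zero

theorem real_to_rat {I : Type} [Fintype I] {n : ℕ} (a : I → Fin n → ℤ) (w : Fin n → ℤ) (c : I → ℝ)
    (h : ∀ j, ∑ i, c i * (a i j : ℝ) = (w j : ℝ)) :
    ∃ c' : I → ℚ, ∀ j, ∑ i, c' i * (a i j : ℚ) = (w j : ℚ) := by
  obtain ⟨φ, hφ⟩ := LinearMap.exists_leftInverse_of_injective (Algebra.linearMap ℚ ℝ)
    (LinearMap.ker_eq_bot.mpr (algebraMap ℚ ℝ).injective)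
  have h1 : ∀ q : ℚ, φ (q : ℝ) = q := fun q => by
    simpa using LinearMap.congr_fun hφ q
  refine ⟨fun i => φ (c i), fun j => ?_⟩
  have := congrArg φ (h j)
  rw [map_sum] at this
  have e : ((w j : ℤ) : ℝ) = ((w j : ℚ) : ℝ) := by simp
  rw [e, h1] at this
  rw [← this]
  refine Finset.sum_congr rfl (fun i _ => ?_)
  have : c i * (a i j : ℝ) = (a i j : ℚ) • c i := by
    rw [Rat.smul_def]; push_cast; ring
  rw [this, map_smul, smul_eq_mul, mul_comm]

theorem minor_mul_mem {I : Type} [Fintype I] {n r : ℕ} (a : I → Fin n → ℤ) (w : Fin n → ℤ)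
    (c : I → ℚ) (h : ∀ j, ∑ i, c i * (a i j : ℚ) = (w j : ℚ))
    (hr : (Matrix.of (fun i j => (a i j : ℚ))).rank = r) (f : Fin r → I) (g : Fin r → Fin n) :
    ∃ z : I → ℤ, ∀ j, ∑ i, z i * a i j = (Matrix.of (fun i j => a (f i) (g j))).det * w j := by
  set B : Matrix (Fin r) (Fin r) ℤ := Matrix.of (fun i j => a (f i) (g j)) with hB
  by_cases hD : B.det = 0
  · exact ⟨0, fun j => by simp [hD]⟩
  set BQ : Matrix (Fin r) (Fin r) ℚ := B.map (Int.castRingHom ℚ) with hBQ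
  have hdet : BQ.det = (B.det : ℚ) := by
    rw [hBQ, ← RingHom.mapMatrix_apply, ← RingHom.map_det]; simp
  have hindB : LinearIndependent ℚ BQ.row := by
    rw [Matrix.linearIndependent_rows_iff_isUnit, Matrix.isUnit_iff_isUnit_det, hdet]
    exact isUnit_iff_ne_zero.mpr (by exact_mod_cast hD)
  have hind : LinearIndependent ℚ (fun k : Fin r => fun j : Fin n => (a (f k) j : ℚ)) := by
    apply LinearIndependent.of_comp (LinearMap.funLeft ℚ ℚ g)
    exact hindB
  have hle : Submodule.span ℚ (Set.range (fun k : Fin r => fun j : Fin n => (a (f k) j : ℚ))) ≤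
      Submodule.span ℚ (Set.range (Matrix.of (fun i j => (a i j : ℚ))).row) := by
    apply Submodule.span_mono
    rintro _ ⟨k, rfl⟩
    exact ⟨f k, rfl⟩
  have heq := Submodule.eq_of_le_of_finrank_eq hle (by
    rw [finrank_span_eq_card hind, ← Matrix.rank_eq_finrank_span_row, hr]; simp)
  have hw : (fun j => (w j : ℚ)) ∈
      Submodule.span ℚ (Set.range (fun k : Fin r => fun j : Fin n => (a (f k) j : ℚ))) := by
    rw [heq]
    have : (fun j => (w j : ℚ)) = ∑ i, c i • (Matrix.of (fun i j => (a i j : ℚ))).row i := by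
      funext j
      simp [Finset.sum_apply, ← h j]
    rw [this]
    exact Submodule.sum_mem _ (fun i _ => Submodule.smul_mem _ _
      (Submodule.subset_span (Set.mem_range_self i)))
  rw [Submodule.mem_span_range_iff_exists_fun] at hw
  obtain ⟨e, he⟩ := hw
  have he' : ∀ j, ∑ k, e k * (a (f k) j : ℚ) = (w j : ℚ) := fun j => by
    have := congrFun he j
    simpa [Finset.sum_apply] using this
  -- Cramer
  have hcr : Matrix.vecMul e BQ = fun k => (w (g k) : ℚ) := by
    funext k
    rw [← he' (g k)]
    simp [Matrix.vecMul, dotProduct, hBQ, hB]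
  set z0 : Fin r → ℤ := Matrix.vecMul (fun k => w (g k)) B.adjugate with hz0
  have hz : ∀ k, (z0 k : ℚ) = (B.det : ℚ) * e k := by
    intro k
    have h1 : Matrix.vecMul (fun k => (w (g k) : ℚ)) BQ.adjugate = (B.det : ℚ) • e := by
      rw [← hcr, Matrix.vecMul_vecMul, Matrix.mul_adjugate, Matrix.vecMul_smul, Matrix.vecMul_one,
        hdet]
    have h2 := congrFun h1 k
    rw [Pi.smul_apply, smul_eq_mul] at h2
    rw [← h2, hz0]
    have h3 : BQ.adjugate = B.adjugate.map (Int.castRingHom ℚ) := by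
      rw [hBQ, ← RingHom.mapMatrix_apply, ← RingHom.mapMatrix_apply, RingHom.map_adjugate]
    rw [h3]
    simp [Matrix.vecMul, dotProduct]
  refine ⟨fun i => ∑ k, if f k = i then z0 k else 0, fun j => ?_⟩
  have h4 : ∑ i, (∑ k, if f k = i then z0 k else 0) * a i j = ∑ k, z0 k * a (f k) j := by
    simp only [Finset.sum_mul]
    rw [Finset.sum_comm]
    refine Finset.sum_congr rfl (fun k _ => ?_)
    simp [ite_mul]
  rw [h4]
  have h5 : (∑ k, (z0 k : ℚ) * (a (f k) j : ℚ)) = (B.det : ℚ) * (w j : ℚ) := by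
    rw [← he' j, Finset.mul_sum]
    exact Finset.sum_congr rfl (fun k _ => by rw [hz]; ring)
  exact_mod_cast h5

theorem int_gen {I : Type} [Fintype I] {n r : ℕ} (a : I → Fin n → ℤ) (w : Fin n → ℤ)
    (c : I → ℝ) (h : ∀ j, ∑ i, c i * (a i j : ℝ) = (w j : ℝ))
    (hr : (Matrix.of (fun i j => (a i j : ℚ))).rank = r)
    (H : ∀ d : ℤ, (∀ (f : Fin r → I) (g : Fin r → Fin n), Function.Injective f →
      Function.Injective g → d ∣ (Matrix.of (fun i j => a (f i) (g j))).det) → IsUnit d) :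
    ∃ z : I → ℤ, ∀ j, ∑ i, z i * a i j = w j := by
  obtain ⟨c', hc'⟩ := real_to_rat a w c h
  let Id : Ideal ℤ :=
    { carrier := {t | ∃ z : I → ℤ, ∀ j, ∑ i, z i * a i j = t * w j}
      add_mem' := by
        rintro s t ⟨x, hx⟩ ⟨y, hy⟩
        exact ⟨x + y, fun j => by simp [add_mul, Finset.sum_add_distrib, hx, hy]⟩
      zero_mem' := ⟨0, fun j => by simp⟩
      smul_mem' := by
        rintro s t ⟨x, hx⟩
        exact ⟨s • x, fun j => by simp [mul_assoc, ← Finset.mul_sum, hx]⟩ }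
  have hu := H (Submodule.IsPrincipal.generator Id) (fun f g _ _ => by
    rw [← Submodule.IsPrincipal.mem_iff_generator_dvd]
    exact minor_mul_mem a w c' hc' hr f g)
  have h1 : (1 : ℤ) ∈ Id := by
    rw [Submodule.IsPrincipal.mem_iff_generator_dvd]
    exact hu.dvd
  obtain ⟨z, hz⟩ := h1
  exact ⟨z, fun j => by simpa using hz j⟩

theorem padic_add {p : ℕ} (hp : p.Prime) {x y : ℝ} (hx : IsPadic p x) (hy : IsPadic p y) :
    IsPadic p (x + y) := by
  obtain ⟨a, k, rfl⟩ := hx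
  obtain ⟨b, l, rfl⟩ := hy
  have : (p : ℝ) ≠ 0 := by exact_mod_cast hp.ne_zero
  refine ⟨a * p ^ l + b * p ^ k, k + l, ?_⟩
  push_cast
  rw [pow_add]
  field_simp

theorem padic_int {p : ℕ} (a : ℤ) : IsPadic p (a : ℝ) := ⟨a, 0, by simp⟩

theorem padic_int_mul {p : ℕ} (a : ℤ) {x : ℝ} (hx : IsPadic p x) : IsPadic p (a * x) := by
  obtain ⟨b, l, rfl⟩ := hx
  exact ⟨a * b, l, by push_cast; ring⟩

theorem padic_sum {p : ℕ} (hp : p.Prime) {I : Type} (s : Finset I) (x : I → ℝ)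
    (hx : ∀ i ∈ s, IsPadic p (x i)) : IsPadic p (∑ i ∈ s, x i) :=
  Finset.sum_induction x (IsPadic p) (fun _ _ => padic_add hp) ⟨0, 0, by simp⟩ hx

theorem padic_dense {p : ℕ} (hp : p.Prime) : Dense {x : ℝ | IsPadic p x} := by
  apply dense_of_exists_between
  intro a b hab
  have hp1 : (1 : ℝ) < p := by exact_mod_cast hp.one_lt
  obtain ⟨k, hk⟩ := pow_unbounded_of_one_lt (1 / (b - a)) hp1
  have hpk : (0 : ℝ) < (p : ℝ) ^ k := by positivity
  have hba : 0 < b - a := by linarith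
  refine ⟨((⌊a * p ^ k⌋ + 1 : ℤ) : ℝ) / p ^ k, ⟨_, _, rfl⟩, ?_, ?_⟩
  · rw [lt_div_iff₀ hpk]
    push_cast
    exact Int.lt_floor_add_one _
  · rw [div_lt_iff₀ hpk]
    push_cast
    have := Int.floor_le (a * (p : ℝ) ^ k)
    rw [div_lt_iff₀ hba] at hk
    nlinarith

theorem rational_decomp {I : Type} [Fintype I] {n : ℕ} (a : I → Fin n → ℤ) (v : I → ℝ)
    (h : ∀ j, ∑ i, v i * (a i j : ℝ) = 0) :
    ∃ (s : ℕ) (N : Fin s → I → ℤ) (β : Fin s → ℝ), (∀ k j, ∑ i, N k i * a i j = 0) ∧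
      ∀ i, v i = ∑ k, (N k i : ℝ) * β k := by
  let B := Module.Basis.ofVectorSpace ℚ ℝ
  let S : Finset (Module.Basis.ofVectorSpaceIndex ℚ ℝ) :=
    Finset.univ.biUnion (fun i => (B.repr (v i)).support)
  have hq : ∀ k j, ∑ i, B.repr (v i) k * (a i j : ℚ) = 0 := by
    intro k j
    have := congrArg (fun x => B.repr x k) (h j)
    simp only [map_sum, Finsupp.finsetSum_apply, map_zero, Finsupp.coe_zero, Pi.zero_apply] at this
    rw [← this]
    refine Finset.sum_congr rfl (fun i _ => ?_)
    have : v i * (a i j : ℝ) = (a i j : ℚ) • v i := by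
      rw [Rat.smul_def]; push_cast; ring
    rw [this, map_smul, Finsupp.smul_apply, smul_eq_mul, mul_comm]
  have hv : ∀ i, v i = ∑ k ∈ S, (B.repr (v i) k : ℝ) * B k := by
    intro i
    conv_lhs => rw [← B.linearCombination_repr (v i), Finsupp.linearCombination_apply]
    rw [Finsupp.sum_of_support_subset _ (s := S) _ _ (by simp)]
    · exact Finset.sum_congr rfl (fun k _ => by rw [Rat.smul_def])
    · exact Finset.subset_biUnion_of_mem (fun i => (B.repr (v i)).support) (Finset.mem_univ i)
  -- clear denominators
  let D : Module.Basis.ofVectorSpaceIndex ℚ ℝ → ℕ := fun k => ∏ i, (B.repr (v i) k).den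
  have hD : ∀ k, (D k : ℚ) ≠ 0 := fun k => by
    exact_mod_cast Finset.prod_ne_zero_iff.mpr (fun i _ => (B.repr (v i) k).den_nz)
  have hN : ∀ k i, ∃ z : ℤ, (z : ℚ) = D k * B.repr (v i) k := by
    intro k i
    obtain ⟨e, he⟩ : (B.repr (v i) k).den ∣ D k := Finset.dvd_prod_of_mem _ (Finset.mem_univ i)
    refine ⟨e * (B.repr (v i) k).num, ?_⟩
    rw [he]
    push_cast
    rw [← Rat.mul_den_eq_num (B.repr (v i) k)]
    ring
  choose N hN using hN
  refine ⟨S.card, fun k => N (S.equivFin.symm k), fun k => B (S.equivFin.symm k) / D (S.equivFin.symm k), ?_, ?_⟩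
  · intro k j
    have : ∑ i, (N (S.equivFin.symm k) i : ℚ) * (a i j : ℚ) = 0 := by
      simp only [hN, mul_assoc, ← Finset.mul_sum, hq, mul_zero]
    exact_mod_cast this
  · intro i
    rw [hv i, ← Finset.sum_coe_sort, ← Equiv.sum_comp S.equivFin.symm]
    refine Finset.sum_congr rfl (fun k _ => ?_)
    have h1 := hN (S.equivFin.symm k) i
    have h2 : (N (S.equivFin.symm k) i : ℝ) =
      D (S.equivFin.symm k) * (B.repr (v i) (S.equivFin.symm k) : ℝ) := by exact_mod_cast h1
    have h3 : (D (S.equivFin.symm k) : ℝ) ≠ 0 := by exact_mod_cast hD (S.equivFin.symm k)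
    rw [h2]
    field_simp

theorem padic_approx {p : ℕ} (hp : p.Prime) {I : Type} [Fintype I] {n : ℕ} (a : I → Fin n → ℤ)
    (w : Fin n → ℤ) (y : I → ℝ) (hy : ∀ i, 0 < y i) (h : ∀ j, ∑ i, y i * (a i j : ℝ) = (w j : ℝ))
    (z : I → ℤ) (hz : ∀ j, ∑ i, z i * a i j = w j) :
    ∃ u : I → ℝ, (∀ i, 0 < u i) ∧ (∀ i, IsPadic p (u i)) ∧
      ∀ j, ∑ i, u i * (a i j : ℝ) = (w j : ℝ) := by
  have hz' : ∀ j, ∑ i, (z i : ℝ) * (a i j : ℝ) = (w j : ℝ) := fun j => by exact_mod_cast hz j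
  obtain ⟨s, N, β, hN, hβ⟩ := rational_decomp a (fun i => y i - z i) (fun j => by
    simp only [sub_mul, Finset.sum_sub_distrib, h, hz', sub_self])
  have hd : Dense (Set.univ.pi (fun _ : Fin s => {x : ℝ | IsPadic p x})) :=
    dense_pi _ (fun _ _ => padic_dense hp)
  have ho : IsOpen {c : Fin s → ℝ | ∀ i, 0 < (z i : ℝ) + ∑ k, (N k i : ℝ) * c k} := by
    rw [Set.ofPred_forall]
    exact isOpen_iInter_of_finite (fun i => isOpen_lt (by fun_prop) (by fun_prop))
  obtain ⟨c, hc1, hc2⟩ := hd.exists_mem_open ho ⟨β, fun i => by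
    have := hβ i
    have := hy i
    linarith⟩
  refine ⟨_, hc2, fun i => padic_add hp (padic_int _) (padic_sum hp _ _ (fun k _ =>
    padic_int_mul _ (hc1 k (Set.mem_univ k)))), fun j => ?_⟩
  simp only [add_mul, Finset.sum_add_distrib, hz', Finset.sum_mul]
  rw [Finset.sum_comm]
  have : ∀ k, ∑ i, (N k i : ℝ) * c k * (a i j : ℝ) = 0 := fun k => by
    have h1 : ∑ i, (N k i : ℝ) * (a i j : ℝ) = 0 := by exact_mod_cast hN k j
    rw [← mul_zero (c k), ← h1, Finset.mul_sum]
    exact Finset.sum_congr rfl (fun i _ => by ring)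
  simp [this]

theorem padic_clear {p : ℕ} (hp : p.Prime) {I : Type} [Fintype I] (x : I → ℝ)
    (hx : ∀ i, IsPadic p (x i)) : ∃ (K : ℕ) (t : I → ℤ), ∀ i, (t i : ℝ) = (p : ℝ) ^ K * x i := by
  choose a k h using hx
  have : (p : ℝ) ≠ 0 := by exact_mod_cast hp.ne_zero
  refine ⟨∑ i, k i, fun i => a i * p ^ (∑ i, k i - k i), fun i => ?_⟩
  have hk : k i ≤ ∑ i, k i := Finset.single_le_sum (fun _ _ => Nat.zero_le _) (Finset.mem_univ i)
  have e : (p : ℝ) ^ (∑ i, k i) = p ^ (∑ i, k i - k i) * p ^ k i := by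
    rw [← pow_add, Nat.sub_add_cancel hk]
  rw [h i, e]
  push_cast
  field_simp

theorem exists_minor_not_dvd {p l : ℕ} (hp : p.Prime) (hl : l.Prime) (hpl : p ≠ l)
    {I : Type} [Fintype I] {n r : ℕ} (a : I → Fin n → ℤ)
    (hr : (Matrix.of (fun i j => (a i j : ℚ))).rank = r)
    (H : ∀ w : Fin n → ℤ, (∃ c : I → ℚ, ∀ j, ∑ i, c i * (a i j : ℚ) = (w j : ℚ)) →
      ∃ c : I → ℝ, (∀ i, IsPadic p (c i)) ∧ ∀ j, ∑ i, c i * (a i j : ℝ) = (w j : ℝ)) :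
    ∃ (f : Fin r → I) (g : Fin r → Fin n), Function.Injective f ∧ Function.Injective g ∧
      ¬ (l : ℤ) ∣ (Matrix.of (fun i j => a (f i) (g j))).det := by
  have : Fact l.Prime := ⟨hl⟩
  let L : Submodule ℤ (Fin n → ℤ) :=
    { carrier := {w | ∃ c : I → ℚ, ∀ j, ∑ i, c i * (a i j : ℚ) = (w j : ℚ)}
      add_mem' := by
        rintro s t ⟨x, hx⟩ ⟨y, hy⟩
        exact ⟨x + y, fun j => by simp [add_mul, Finset.sum_add_distrib, hx, hy]⟩
      zero_mem' := ⟨0, fun j => by simp⟩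
      smul_mem' := by
        rintro s t ⟨x, hx⟩
        exact ⟨(s : ℚ) • x, fun j => by simp [mul_assoc, ← Finset.mul_sum, hx]⟩ }
  obtain ⟨s, B⟩ := Submodule.basisOfPid (Pi.basisFun ℤ (Fin n)) L
  let v : Fin s → Fin n → ℤ := fun k => (B k : Fin n → ℤ)
  have hrep : ∀ u ∈ L, ∃ e : Fin s → ℤ, ∀ j, u j = ∑ k, e k * v k j := by
    intro u hu
    refine ⟨fun k => B.repr ⟨u, hu⟩ k, fun j => ?_⟩
    have h1 : ((∑ k, B.repr ⟨u, hu⟩ k • B k : L) : Fin n → ℤ) = u := by rw [B.sum_repr]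
    have h2 := congrFun h1 j
    rw [Submodule.coe_sum, Finset.sum_apply] at h2
    exact h2.symm
  have hindep : ∀ e : Fin s → ℤ, (∀ j, ∑ k, e k * v k j = 0) → ∀ k, e k = 0 := by
    intro e he
    apply Fintype.linearIndependent_iff.mp B.linearIndependent e
    apply Subtype.ext
    funext j
    simpa [Submodule.coe_sum, Finset.sum_apply, v] using he j
  have haL : ∀ i, a i ∈ L := fun i => ⟨Pi.single i 1, fun j => by simp [Pi.single_apply]⟩
  have hrs : r ≤ s := by
    rw [← hr, Matrix.rank_eq_finrank_span_row]
    have h1 := finrank_range_le_card (R := ℚ) (fun (k : Fin s) (j : Fin n) => (v k j : ℚ))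
    rw [Fintype.card_fin] at h1
    refine le_trans (Submodule.finrank_mono ?_) h1
    rw [Submodule.span_le]
    rintro _ ⟨i, rfl⟩
    obtain ⟨e, he⟩ := hrep _ (haL i)
    rw [SetLike.mem_coe, Submodule.mem_span_range_iff_exists_fun]
    refine ⟨fun k => (e k : ℚ), ?_⟩
    funext j
    have := he j
    simp [Finset.sum_apply, this]
  have hmod : LinearIndependent (ZMod l) (fun (k : Fin s) (j : Fin n) => (v k j : ZMod l)) := by
    rw [Fintype.linearIndependent_iff]
    intro c hc
    obtain ⟨c', rfl⟩ : ∃ c' : Fin s → ℤ, (fun k => (c' k : ZMod l)) = c := by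
      choose c' hc' using fun k => ZMod.intCast_surjective (c k)
      exact ⟨c', funext hc'⟩
    have h1 : ∀ j, (l : ℤ) ∣ ∑ k, c' k * v k j := by
      intro j
      rw [← ZMod.intCast_zmod_eq_zero_iff_dvd]
      have := congrFun hc j
      simpa [Finset.sum_apply] using this
    choose u hu using h1
    have hlQ : (l : ℚ) ≠ 0 := by exact_mod_cast hl.ne_zero
    have huL : u ∈ L := by
      have h2 : (fun j => ∑ k, c' k * v k j) ∈ L := by
        have : (fun j => ∑ k, c' k * v k j) = ∑ k, c' k • v k := by
          funext j; simp [Finset.sum_apply]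
        rw [this]
        exact Submodule.sum_mem _ (fun k _ => Submodule.smul_mem _ _ (B k).2)
      obtain ⟨x, hx⟩ := h2
      refine ⟨fun i => (l : ℚ)⁻¹ * x i, fun j => ?_⟩
      have h3 := hx j
      simp only [hu j] at h3
      simp only [mul_assoc, ← Finset.mul_sum, h3]
      push_cast
      field_simp
    obtain ⟨e, he⟩ := hrep u huL
    intro k
    have h4 := hindep (fun k => c' k - l * e k) (fun j => by
      simp only [sub_mul, Finset.sum_sub_distrib, hu, mul_assoc, ← Finset.mul_sum, ← he, sub_self]) k
    have h5 : c' k = l * e k := by linarith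
    simp [h5]
  have hspan : ∀ k, (fun j : Fin n => (v k j : ZMod l)) ∈ Submodule.span (ZMod l)
      (Set.range (Matrix.of (fun i j => (a i j : ZMod l))).row) := by
    intro k
    obtain ⟨c, hc1, hc2⟩ := H (v k) (B k).2
    obtain ⟨K, t, ht⟩ := padic_clear hp c hc1
    have h1 : ∀ j, ∑ i, t i * a i j = (p : ℤ) ^ K * v k j := by
      intro j
      have : ∑ i, (t i : ℝ) * (a i j : ℝ) = (p : ℝ) ^ K * v k j := by
        simp only [ht, mul_assoc, ← Finset.mul_sum, hc2]
      exact_mod_cast this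
    have hpl' : (p : ZMod l) ≠ 0 := by
      rw [Ne, ZMod.natCast_eq_zero_iff]
      intro hdvd
      exact hpl ((Nat.prime_dvd_prime_iff_eq hl hp).mp hdvd).symm
    rw [Submodule.mem_span_range_iff_exists_fun]
    refine ⟨fun i => ((p : ZMod l) ^ K)⁻¹ * (t i : ZMod l), ?_⟩
    funext j
    have h2 := congrArg (Int.cast : ℤ → ZMod l) (h1 j)
    push_cast at h2
    simp only [Finset.sum_apply, Pi.smul_apply, smul_eq_mul, Matrix.row, Matrix.of_apply, mul_assoc,
      ← Finset.mul_sum, h2]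
    field_simp
  have hrank : r ≤ (Matrix.of (fun i j => (a i j : ZMod l))).rank := by
    refine hrs.trans ?_
    rw [Matrix.rank_eq_finrank_span_row]
    have h1 := finrank_span_eq_card hmod
    rw [Fintype.card_fin] at h1
    refine h1.symm.le.trans (Submodule.finrank_mono ?_)
    rw [Submodule.span_le]
    rintro _ ⟨k, rfl⟩
    exact hspan k
  obtain ⟨f, g, hf, hg, hd⟩ := exists_minor _ hrank
  refine ⟨f, g, hf, hg, ?_⟩
  rw [← ZMod.intCast_zmod_eq_zero_iff_dvd]
  intro h0
  apply hd
  rw [← h0]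
  have := RingHom.map_det (Int.castRingHom (ZMod l)) (Matrix.of (fun i j => a (f i) (g j)))
  simp only [eq_intCast] at this
  rw [this]
  congr 1

theorem sum_restrict {m : ℕ} (P : Fin m → Prop) (φ : Fin m → ℝ) (h : ∀ i, ¬ P i → φ i = 0) :
    ∑ i : {i // P i}, φ i.1 = ∑ i, φ i := by
  rw [← Finset.sum_subtype (Finset.univ.filter P) (by simp) φ]
  exact Finset.sum_subset (Finset.filter_subset _ _) (fun i _ hi => h i (by simpa using hi))

theorem compl_slack {m n : ℕ} {A : Matrix (Fin m) (Fin n) ℤ} {b : Fin m → ℤ} {w : Fin n → ℤ}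
    {y : Fin m → ℝ} (hy : DualFeasible A w y) {F : Set (Fin n → ℝ)}
    (hF : ∀ x ∈ F, ∀ i, ∑ j, (A i j : ℝ) * x j ≤ (b i : ℝ))
    (hv : ∀ x ∈ F, ∑ i, (b i : ℝ) * y i = ∑ j, (w j : ℝ) * x j)
    (i : Fin m) (hi : ¬ ∀ x ∈ F, ∑ j, (A i j : ℝ) * x j = (b i : ℝ)) : y i = 0 := by
  push Not at hi
  obtain ⟨x, hx, hne⟩ := hi
  have h1 := weak_duality (b := b) hy.2 x
  rw [hv x hx, sub_self] at h1
  rw [Finset.sum_eq_zero_iff_of_nonneg (fun k _ => mul_nonneg (hy.1 k)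
    (sub_nonneg.mpr (hF x hx k)))] at h1
  rcases mul_eq_zero.mp (h1 i (Finset.mem_univ i)) with h | h
  · exact h
  · exact absurd (by linarith) hne

theorem weak_le {m n : ℕ} {A : Matrix (Fin m) (Fin n) ℤ} {b : Fin m → ℤ} {w : Fin n → ℤ}
    {y : Fin m → ℝ} (hy : DualFeasible A w y) {x : Fin n → ℝ}
    (hx : ∀ i, ∑ j, (A i j : ℝ) * x j ≤ (b i : ℝ)) :
    ∑ j, (w j : ℝ) * x j ≤ ∑ i, (b i : ℝ) * y i := by
  have h1 := weak_duality (b := b) hy.2 x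
  have h2 : 0 ≤ ∑ i, y i * ((b i : ℝ) - ∑ j, (A i j : ℝ) * x j) :=
    Finset.sum_nonneg (fun k _ => mul_nonneg (hy.1 k) (sub_nonneg.mpr (hx k)))
  linarith

theorem value_eq {m n : ℕ} {A : Matrix (Fin m) (Fin n) ℤ} {b : Fin m → ℤ} {w : Fin n → ℤ}
    {y : Fin m → ℝ} (hy : DualFeasible A w y) {F : Set (Fin n → ℝ)}
    (h0 : ∀ i, (¬ ∀ x ∈ F, ∑ j, (A i j : ℝ) * x j = (b i : ℝ)) → y i = 0) {x : Fin n → ℝ}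
    (hx : x ∈ F) : ∑ i, (b i : ℝ) * y i = ∑ j, (w j : ℝ) * x j := by
  have h1 := weak_duality (b := b) hy.2 x
  have h2 : ∑ i, y i * ((b i : ℝ) - ∑ j, (A i j : ℝ) * x j) = 0 := by
    refine Finset.sum_eq_zero (fun i _ => ?_)
    by_cases hi : ∀ x ∈ F, ∑ j, (A i j : ℝ) * x j = (b i : ℝ)
    · rw [hi x hx]; simp
    · rw [h0 i hi]; simp
  linarith

theorem face_minor {p l : ℕ} (hp : p.Prime) (hl : l.Prime) (hpl : p ≠ l) {m n : ℕ}
    (A : Matrix (Fin m) (Fin n) ℤ) (b : Fin m → ℤ) (hT : TotallyDualPadic p A b)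
    (F : Set (Fin n → ℝ)) (hF : ∀ x ∈ F, ∀ i, ∑ j, (A i j : ℝ) * x j ≤ (b i : ℝ))
    (hne : F.Nonempty) (r : ℕ)
    (hr : (Matrix.of (fun (i : {i : Fin m // ∀ x ∈ F, ∑ j, (A i j : ℝ) * x j = (b i : ℝ)})
            (j : Fin n) => ((A i.1 j : ℚ)))).rank = r) :
    ∃ (f : Fin r → {i : Fin m // ∀ x ∈ F, ∑ j, (A i j : ℝ) * x j = (b i : ℝ)})
      (g : Fin r → Fin n), Function.Injective f ∧ Function.Injective g ∧
      ¬ (l : ℤ) ∣ (Matrix.of (fun i j => A (f i).1 (g j))).det := by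
  refine exists_minor_not_dvd hp hl hpl
    (fun (i : {i : Fin m // ∀ x ∈ F, ∑ j, (A i j : ℝ) * x j = (b i : ℝ)}) j => A i.1 j) hr ?_
  rintro w ⟨c, hc⟩
  have hcR : ∀ j, ∑ i, (c i : ℝ) * (A i.1 j : ℝ) = (w j : ℝ) := fun j => by exact_mod_cast hc j
  obtain ⟨N, hN⟩ : ∃ N : ℕ, ∀ i, 0 ≤ (c i : ℝ) + N := by
    obtain ⟨N, hN⟩ := exists_nat_ge (∑ i, |(c i : ℝ)|)
    refine ⟨N, fun i => ?_⟩
    have h1 := Finset.single_le_sum (f := fun i => |(c i : ℝ)|) (fun _ _ => abs_nonneg _)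
      (Finset.mem_univ i)
    have h2 := neg_abs_le (c i : ℝ)
    beta_reduce at h1
    linarith
  let w' : Fin n → ℤ := fun j => w j +
    N * ∑ i : {i : Fin m // ∀ x ∈ F, ∑ j, (A i j : ℝ) * x j = (b i : ℝ)}, A i.1 j
  let y : Fin m → ℝ := fun i =>
    if h : ∀ x ∈ F, ∑ j, (A i j : ℝ) * x j = (b i : ℝ) then (c ⟨i, h⟩ : ℝ) + N else 0
  have hy0 : ∀ i, (¬ ∀ x ∈ F, ∑ j, (A i j : ℝ) * x j = (b i : ℝ)) → y i = 0 := fun i hi => by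
    simp only [y, dif_neg hi]
  have hyf : DualFeasible A w' y := by
    refine ⟨fun i => ?_, fun j => ?_⟩
    · by_cases h : ∀ x ∈ F, ∑ j, (A i j : ℝ) * x j = (b i : ℝ)
      · simp only [y, dif_pos h]; exact hN _
      · rw [hy0 i h]
    · rw [← sum_restrict _ (fun i => y i * (A i j : ℝ)) (fun i hi => by rw [hy0 i hi, zero_mul])]
      have : ∀ i : {i : Fin m // ∀ x ∈ F, ∑ j, (A i j : ℝ) * x j = (b i : ℝ)},
          y i.1 = (c i : ℝ) + N := fun i => by simp only [y, dif_pos i.2]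
      simp only [this, add_mul, Finset.sum_add_distrib, hcR, w']
      push_cast
      rw [Finset.mul_sum]
  obtain ⟨x0, hx0⟩ := hne
  have hyo : DualOptimal A b w' y := ⟨hyf, fun y' hy' => by
    rw [value_eq hyf hy0 hx0]
    exact weak_le hy' (hF x0 hx0)⟩
  obtain ⟨z, hzo, hzp⟩ := hT w' ⟨y, hyo⟩
  have hval : ∑ i, (b i : ℝ) * z i = ∑ i, (b i : ℝ) * y i :=
    le_antisymm (hzo.2 y hyf) (hyo.2 z hzo.1)
  have hz0 := compl_slack hzo.1 hF (fun x hx => by rw [hval]; exact value_eq hyf hy0 hx)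
  refine ⟨fun i => z i.1 + ((-N : ℤ) : ℝ), fun i => padic_add hp (hzp _) (padic_int _), fun j => ?_⟩
  have h1 := hzo.1.2 j
  rw [← sum_restrict _ (fun i => z i * (A i j : ℝ)) (fun i hi => by rw [hz0 i hi, zero_mul])] at h1
  simp only [add_mul, Finset.sum_add_distrib, h1, w', ← Finset.mul_sum]
  push_cast
  ring

theorem three_one {p : ℕ} (hp : p.Prime) {m n : ℕ}
    (A : Matrix (Fin m) (Fin n) ℤ) (b : Fin m → ℤ)
    (H : ∀ F : Set (Fin n → ℝ),
        IsFace {x | ∀ i, ∑ j, (A i j : ℝ) * x j ≤ (b i : ℝ)} F → F.Nonempty →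
        ∀ r : ℕ,
          (Matrix.of (fun (i : {i : Fin m // ∀ x ∈ F, ∑ j, (A i j : ℝ) * x j = (b i : ℝ)})
            (j : Fin n) => ((A i.1 j : ℚ)))).rank = r →
          ∀ d : ℤ,
            (∀ (f : Fin r → {i : Fin m // ∀ x ∈ F, ∑ j, (A i j : ℝ) * x j = (b i : ℝ)})
              (g : Fin r → Fin n), Function.Injective f → Function.Injective g →
              d ∣ (Matrix.of (fun (i : Fin r) (j : Fin r) => A (f i).1 (g j))).det) →
            IsUnit d) : TotallyDualPadic p A b := by
  rintro w ⟨y0, hy0⟩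
  let F : Set (Fin n → ℝ) := {x ∈ {x | ∀ i, ∑ j, (A i j : ℝ) * x j ≤ (b i : ℝ)} |
    ∑ j, (w j : ℝ) * x j = ∑ i, (b i : ℝ) * y0 i}
  have hF : ∀ x ∈ F, ∀ i, ∑ j, (A i j : ℝ) * x j ≤ (b i : ℝ) := fun x hx => hx.1
  have hface : IsFace {x | ∀ i, ∑ j, (A i j : ℝ) * x j ≤ (b i : ℝ)} F :=
    ⟨fun j => (w j : ℝ), ∑ i, (b i : ℝ) * y0 i, fun x hx => weak_le hy0.1 hx, rfl⟩
  obtain ⟨x0, hx0, hx1⟩ := primal_nonempty hy0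
  have hx0F : x0 ∈ F := ⟨hx0, le_antisymm (weak_le hy0.1 hx0) hx1⟩
  let S := {i : Fin m // ∀ x ∈ F, ∑ j, (A i j : ℝ) * x j = (b i : ℝ)}
  -- optimal solutions are supported on S
  have hopt : ∀ y, DualOptimal A b w y → ∀ j, ∑ i : S, y i.1 * (A i.1 j : ℝ) = w j := by
    intro y hy j
    have hval : ∑ i, (b i : ℝ) * y i = ∑ i, (b i : ℝ) * y0 i :=
      le_antisymm (hy.2 _ hy0.1) (hy0.2 _ hy.1)
    have h0 := compl_slack hy.1 hF (fun x hx => by rw [hval]; exact hx.2.symm)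
    rw [← hy.1.2 j]
    exact sum_restrict _ (fun i => y i * (A i j : ℝ)) (fun i hi => by rw [h0 i hi, zero_mul])
  have hpos : ∀ i : S, ∃ y', DualOptimal A b w y' ∧ 0 < y' i.1 := fun i =>
    primal_strict hy0 i.1 (fun x hx hx' =>
      (i.2 x ⟨hx, le_antisymm (weak_le hy0.1 hx) hx'⟩).symm.le)
  choose Y hY hYpos using hpos
  have hcard : (0 : ℝ) < 1 + Fintype.card S := by positivity
  let ybar : S → ℝ := fun i => (1 + (Fintype.card S : ℝ))⁻¹ * (y0 i.1 + ∑ k, Y k i.1)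
  have hybar : ∀ i, 0 < ybar i := fun i => by
    refine mul_pos (inv_pos.mpr hcard) ?_
    have h1 := Finset.single_le_sum (f := fun k => Y k i.1) (fun k _ => (hY k).1.1 i.1)
      (Finset.mem_univ i)
    have h2 := hYpos i
    have h3 := hy0.1.1 i.1
    beta_reduce at h1
    linarith
  have hyw : ∀ j, ∑ i, ybar i * (A i.1 j : ℝ) = (w j : ℝ) := fun j => by
    simp only [ybar, mul_assoc, ← Finset.mul_sum, add_mul, Finset.sum_add_distrib, Finset.sum_mul]
    rw [Finset.sum_comm, hopt y0 hy0 j]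
    simp only [fun k => hopt (Y k) (hY k) j]
    rw [Finset.sum_const, Finset.card_univ, nsmul_eq_mul]
    field_simp
  obtain ⟨z, hz⟩ := int_gen (fun (i : S) j => A i.1 j) w ybar hyw rfl (H F hface ⟨x0, hx0F⟩ _ rfl)
  obtain ⟨u, hu0, hup, hu⟩ := padic_approx hp (fun (i : S) j => A i.1 j) w ybar hybar hyw z hz
  let y : Fin m → ℝ := fun i =>
    if h : ∀ x ∈ F, ∑ j, (A i j : ℝ) * x j = (b i : ℝ) then u ⟨i, h⟩ else 0
  have hyS : ∀ i : S, y i.1 = u i := fun i => dif_pos i.2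
  have hyN : ∀ i, (¬ ∀ x ∈ F, ∑ j, (A i j : ℝ) * x j = (b i : ℝ)) → y i = 0 := fun i hi => by
    simp only [y, dif_neg hi]
  have hyf : DualFeasible A w y := by
    refine ⟨fun i => ?_, fun j => ?_⟩
    · by_cases h : ∀ x ∈ F, ∑ j, (A i j : ℝ) * x j = (b i : ℝ)
      · exact (hyS ⟨i, h⟩).symm ▸ (hu0 _).le
      · rw [hyN i h]
    · rw [← sum_restrict _ (fun i => y i * (A i j : ℝ)) (fun i hi => by rw [hyN i hi, zero_mul]),
        ← hu j]
      exact Finset.sum_congr rfl (fun i _ => by rw [hyS i])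
  refine ⟨y, ⟨hyf, fun y' hy' => ?_⟩, fun i => ?_⟩
  · rw [value_eq hyf hyN hx0F]
    exact weak_le hy' hx0
  · by_cases h : ∀ x ∈ F, ∑ j, (A i j : ℝ) * x j = (b i : ℝ)
    · exact (hyS ⟨i, h⟩).symm ▸ hup _
    · rw [hyN i h]; exact ⟨0, 0, by simp⟩

/-- The following are equivalent for integral `A, b` and
`P = {x : Ax ≤ b}`: (1) `Ax ≤ b` is totally dual `p`-adic for every prime `p`;
(2) `Ax ≤ b` is totally dual `p`- and `q`-adic for two distinct primes `p, q`;
(3) for every nonempty face `F` of `P`, the GCD of the subdeterminants of `A_F` of order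
`rank A_F` equals `1` (i.e. every common divisor of these subdeterminants is a unit). -/
theorem totally_dual_padic_all_primes_characterization {m n : ℕ}
    (A : Matrix (Fin m) (Fin n) ℤ) (b : Fin m → ℤ) :
    ((∀ p : ℕ, p.Prime → TotallyDualPadic p A b) ↔
      (∃ p q : ℕ, p.Prime ∧ q.Prime ∧ p ≠ q ∧
        TotallyDualPadic p A b ∧ TotallyDualPadic q A b)) ∧
    ((∀ p : ℕ, p.Prime → TotallyDualPadic p A b) ↔
      (∀ F : Set (Fin n → ℝ),
        IsFace {x | ∀ i, ∑ j, (A i j : ℝ) * x j ≤ (b i : ℝ)} F → F.Nonempty →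
        ∀ r : ℕ,
          (Matrix.of (fun (i : {i : Fin m // ∀ x ∈ F, ∑ j, (A i j : ℝ) * x j = (b i : ℝ)})
            (j : Fin n) => ((A i.1 j : ℚ)))).rank = r →
          ∀ d : ℤ,
            (∀ (f : Fin r → {i : Fin m // ∀ x ∈ F, ∑ j, (A i j : ℝ) * x j = (b i : ℝ)})
              (g : Fin r → Fin n), Function.Injective f → Function.Injective g →
              d ∣ (Matrix.of (fun (i : Fin r) (j : Fin r) => A (f i).1 (g j))).det) →
            IsUnit d)) := by
  have h23 : (∃ p q : ℕ, p.Prime ∧ q.Prime ∧ p ≠ q ∧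
        TotallyDualPadic p A b ∧ TotallyDualPadic q A b) →
      (∀ F : Set (Fin n → ℝ),
        IsFace {x | ∀ i, ∑ j, (A i j : ℝ) * x j ≤ (b i : ℝ)} F → F.Nonempty →
        ∀ r : ℕ,
          (Matrix.of (fun (i : {i : Fin m // ∀ x ∈ F, ∑ j, (A i j : ℝ) * x j = (b i : ℝ)})
            (j : Fin n) => ((A i.1 j : ℚ)))).rank = r →
          ∀ d : ℤ,
            (∀ (f : Fin r → {i : Fin m // ∀ x ∈ F, ∑ j, (A i j : ℝ) * x j = (b i : ℝ)})
              (g : Fin r → Fin n), Function.Injective f → Function.Injective g →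
              d ∣ (Matrix.of (fun (i : Fin r) (j : Fin r) => A (f i).1 (g j))).det) →
            IsUnit d) := by
    rintro ⟨p, q, hp, hq, hpq, hTp, hTq⟩ F hF hne r hr d hd
    have hFP : ∀ x ∈ F, ∀ i, ∑ j, (A i j : ℝ) * x j ≤ (b i : ℝ) := by
      obtain ⟨c, δ, _, rfl⟩ := hF
      exact fun x hx => hx.1
    rw [Int.isUnit_iff_natAbs_eq]
    by_contra hne1
    obtain ⟨l, hl, hld⟩ := Nat.exists_prime_and_dvd hne1
    have hld' : (l : ℤ) ∣ d := Int.natCast_dvd.mpr hld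
    obtain ⟨s, hs, hsl, hTs⟩ : ∃ s : ℕ, s.Prime ∧ s ≠ l ∧ TotallyDualPadic s A b := by
      by_cases h : p = l
      · exact ⟨q, hq, fun h' => hpq (h.trans h'.symm), hTq⟩
      · exact ⟨p, hp, h, hTp⟩
    obtain ⟨f, g, hf, hg, hfg⟩ := face_minor hs hl hsl A b hTs F hFP hne r hr
    exact hfg (hld'.trans (hd f g hf hg))
  have h12 : (∀ p : ℕ, p.Prime → TotallyDualPadic p A b) → (∃ p q : ℕ, p.Prime ∧ q.Prime ∧ p ≠ q ∧
        TotallyDualPadic p A b ∧ TotallyDualPadic q A b) := fun h =>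
    ⟨2, 3, Nat.prime_two, Nat.prime_three, by norm_num, h 2 Nat.prime_two, h 3 Nat.prime_three⟩
  exact ⟨⟨h12, fun h p hp => three_one hp A b (h23 h)⟩,
    ⟨fun h => h23 (h12 h), fun h p hp => three_one hp A b h⟩⟩
end
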